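/- Let X be a shift space over a finite alphabet with left shift σ. For any continuous function φ : X → ℝ and any mistake function g : ℕ → ℕ, there is a sequence of positive numbers δ_n → 0 such that whenever x, y ∈ X and m, n ∈ ℕ satisfy d̂(x₁⋯x_n, y₁⋯y_m) ≤ g(n), then |(1/n)∑_{i=0}^{n−1} φ(σ^i x) − (1/m)∑_{i=0}^{m−1} φ(σ^i y)| ≤ δ_n. -/

import Mathlib

open MeasureTheory Filter Topology Set
open scoped ENNReal Classical

namespace Paper

variable {A : Type} [Fintype A] [DecidableEq A] [TopologicalSpace A] [DiscreteTopology A]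
  [MeasurableSpace A] [BorelSpace A]

/-- The left shift map on the full shift `A^ℕ`. -/
def shift : (ℕ → A) → (ℕ → A) := fun x i => x (i + 1)

/-- The cylinder set of a finite word `w`: points whose initial word is `w`. -/
def cylinder (w : List A) : Set (ℕ → A) := {x | ∀ i : Fin w.length, x i = w.get i}

/-- The language of `X`: finite words `w` with `[w] ∩ X ≠ ∅`. -/
def language (X : Set (ℕ → A)) : Set (List A) := {w | (cylinder w ∩ X).Nonempty}

/-- One edit of a word: a substitution, an insertion, or a deletion. -/
def EditStep (w w' : List A) : Prop :=
  (∃ u₁ u₂ : List A, ∃ a a' : A, w = u₁ ++ [a] ++ u₂ ∧ w' = u₁ ++ [a'] ++ u₂) ∨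
  (∃ u₁ u₂ : List A, ∃ a' : A, w = u₁ ++ u₂ ∧ w' = u₁ ++ [a'] ++ u₂) ∨
  (∃ u₁ u₂ : List A, ∃ a : A, w = u₁ ++ [a] ++ u₂ ∧ w' = u₁ ++ u₂)

/-- The edit distance: the minimal number of edits transforming `v` into `w`. -/
noncomputable def editDist (v w : List A) : ℕ :=
  sInf {n | ∃ f : ℕ → List A, f 0 = v ∧ f n = w ∧ ∀ i < n, EditStep (f i) (f (i + 1))}

/-- `G ⊆ L` has (W)-specification (with some gap length `τ`). -/
def HasSpecW (L G : Set (List A)) : Prop :=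
  ∃ τ : ℕ, ∀ v ∈ G, ∀ w ∈ G, ∃ u ∈ L, u.length ≤ τ ∧ v ++ u ++ w ∈ G

/-- A mistake function: nondecreasing with `g n / n → 0`. -/
def MistakeFun (g : ℕ → ℕ) : Prop :=
  Monotone g ∧ Tendsto (fun n => (g n : ℝ) / n) atTop (𝓝 0)

/-- `L` is edit approachable by `G`. -/
def EditApproachable (L G : Set (List A)) : Prop :=
  ∃ g : ℕ → ℕ, MistakeFun g ∧ ∀ w ∈ L, ∃ v ∈ G, editDist v w ≤ g w.length

/-- The shift map restricted to a (shift-invariant) subset `X`, as a self-map of `↥X`. -/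
noncomputable def subShift (X : Set (ℕ → A)) : ↥X → ↥X := fun x =>
  if h : shift x.val ∈ X then ⟨shift x.val, h⟩ else x

/-- Birkhoff sum `S_n φ = ∑_{i<n} φ ∘ σ^i`. -/
def birkhoff {Y : Type*} (σ : Y → Y) (φ : Y → ℝ) (n : ℕ) (y : Y) : ℝ :=
  ∑ i ∈ Finset.range n, φ (σ^[i] y)

/-- The Birkhoff average `(1/n) S_n φ`. -/
noncomputable def birkAvg {Y : Type*} (σ : Y → Y) (φ : Y → ℝ) (n : ℕ) (y : Y) : ℝ :=
  (n : ℝ)⁻¹ * birkhoff σ φ n y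

/-- Carathéodory sum `M(Z,t,φ,N)` over covers of `Z` by cylinders of length `> N`. -/
noncomputable def Mcal (X : Set (ℕ → A)) (φ : ↥X → ℝ) (Z : Set ↥X) (t : ℝ) (N : ℕ) : ℝ≥0∞ :=
  ⨅ (S : Set (List A)) (_ : S.Countable) (_ : ∀ w ∈ S, N < w.length)
    (_ : Z ⊆ ⋃ w ∈ S, Subtype.val ⁻¹' cylinder w),
    ∑' w : S, ENNReal.ofReal (Real.exp (-t * (w : List A).length +
      sSup (birkhoff (subShift X) φ (w : List A).length ''
        (Subtype.val ⁻¹' cylinder (w : List A)))))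

/-- `M(Z,t,φ) = lim_{N→∞} M(Z,t,φ,N)` (the limit of a nondecreasing quantity). -/
noncomputable def McalLim (X : Set (ℕ → A)) (φ : ↥X → ℝ) (Z : Set ↥X) (t : ℝ) : ℝ≥0∞ :=
  ⨆ N : ℕ, Mcal X φ Z t N

/-- The topological pressure `P_Z(φ)` of `Z ⊆ X`. -/
noncomputable def pressure (X : Set (ℕ → A)) (φ : ↥X → ℝ) (Z : Set ↥X) : ℝ :=
  sInf {t : ℝ | McalLim X φ Z t = 0}

/-- The empirical measure `ℰ_n(x) = (1/n) ∑_{i<n} δ_{σ^i x}`. -/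
noncomputable def empiric {Y : Type*} [MeasurableSpace Y] (σ : Y → Y) (n : ℕ) (x : Y) :
    Measure Y := (n : ℝ≥0∞)⁻¹ • ∑ i ∈ Finset.range n, Measure.dirac (σ^[i] x)

/-- The set `A(ℰ_n(x))` of weak* limit points of the sequence of empirical measures of `x`:
probability measures that are limits of the empirical measures along a subsequence. -/
def limitPts {Y : Type*} [MeasurableSpace Y] [TopologicalSpace Y] (σ : Y → Y) (x : Y) :
    Set (ProbabilityMeasure Y) :=
  {μ | ∃ φ : ℕ → ℕ, StrictMono φ ∧ ∀ f : C(Y, ℝ),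
      Tendsto (fun k => birkAvg σ (fun y => f y) (φ k) x) atTop (𝓝 (∫ y, f y ∂μ.toMeasure))}

/-- The saturated set `G_K = {x : A(ℰ_n(x)) = K}`. -/
def saturated {Y : Type*} [MeasurableSpace Y] [TopologicalSpace Y] (σ : Y → Y)
    (K : Set (ProbabilityMeasure Y)) : Set Y := {x | limitPts σ x = K}

/-- The generic points of `μ`: those `x` with `ℰ_n(x) → μ` in the weak* topology. -/
def genericPts {Y : Type*} [MeasurableSpace Y] [TopologicalSpace Y] (σ : Y → Y)
    (μ : ProbabilityMeasure Y) : Set Y :=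
  {x | ∀ f : C(Y, ℝ),
      Tendsto (fun n => birkAvg σ (fun y => f y) n x) atTop (𝓝 (∫ y, f y ∂μ.toMeasure))}

/-- `μ` is a `σ`-invariant (probability) measure. -/
def IsInvariant {Y : Type*} [MeasurableSpace Y] (σ : Y → Y) (μ : ProbabilityMeasure Y) : Prop :=
  μ.toMeasure.map σ = μ.toMeasure

/-- The level set `X(ψ,α)` of points whose Birkhoff averages of `ψ` converge to `α`. -/
def levelSet {Y : Type*} (σ : Y → Y) (ψ : Y → ℝ) (α : ℝ) : Set Y :=
  {x | Tendsto (fun n => birkAvg σ ψ n x) atTop (𝓝 α)}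

/-- The irregular set `X̂(ψ)` of points whose Birkhoff averages of `ψ` do not converge. -/
def irregular {Y : Type*} (σ : Y → Y) (ψ : Y → ℝ) : Set Y :=
  {x | ¬ ∃ α : ℝ, Tendsto (fun n => birkAvg σ ψ n x) atTop (𝓝 α)}

/-- The cylinder of a word of length `n` given as `w : Fin n → A`. -/
def cylF {n : ℕ} (w : Fin n → A) : Set (ℕ → A) := {x | ∀ i : Fin n, x i = w i}

/-- The entropy `H_n(μ)` of the partition of `X` into cylinders of length `n`. -/
noncomputable def wordEntropy (X : Set (ℕ → A)) (μ : ProbabilityMeasure ↥X) (n : ℕ) : ℝ :=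
  ∑ w : Fin n → A, Real.negMulLog ((μ.toMeasure (Subtype.val ⁻¹' cylF w)).toReal)

/-- The measure-theoretic (Kolmogorov–Sinai) entropy `h_μ(σ)` of a shift-invariant measure on a
subshift: by subadditivity, `lim_n H_n/n = inf_{n ≥ 1} H_n/n`. -/
noncomputable def entropy (X : Set (ℕ → A)) (μ : ProbabilityMeasure ↥X) : ℝ :=
  ⨅ n : ℕ, wordEntropy X μ (n + 1) / (n + 1)

/-- The distance `D` on measures induced by a countable family of continuous functions. -/
noncomputable def Dmetric {Y : Type*} [MeasurableSpace Y] [TopologicalSpace Y]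
    (f : ℕ → C(Y, ℝ)) (μ ν : Measure Y) : ℝ :=
  ∑' k : ℕ, ((2 : ℝ) ^ (k + 1))⁻¹ * |(∫ y, f k y ∂μ) - ∫ y, f k y ∂ν|

/-- The family `f` is separating: `D` separates Borel probability measures. -/
def Separating {Y : Type*} [MeasurableSpace Y] [TopologicalSpace Y] (f : ℕ → C(Y, ℝ)) : Prop :=
  ∀ μ ν : ProbabilityMeasure Y,
    (∀ k, (∫ y, f k y ∂μ.toMeasure) = ∫ y, f k y ∂ν.toMeasure) → μ = ν

/-- Diameter of a set with respect to a distance function `d`, valued in `ℝ≥0∞`. -/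
noncomputable def ediam {Y : Type*} (d : Y → Y → ℝ) (U : Set Y) : ℝ≥0∞ :=
  ⨆ x ∈ U, ⨆ y ∈ U, ENNReal.ofReal (d x y)

/-- The `s`-dimensional Hausdorff pre-measure at scale `ε` w.r.t. the distance `d`. -/
noncomputable def hMeasAux {Y : Type*} (d : Y → Y → ℝ) (s : ℝ) (ε : ℝ≥0∞) (Z : Set Y) : ℝ≥0∞ :=
  ⨅ (C : ℕ → Set Y) (_ : Z ⊆ ⋃ n, C n) (_ : ∀ n, ediam d (C n) ≤ ε),
    ∑' n, ⨆ (_ : (C n).Nonempty), ediam d (C n) ^ s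

/-- The `s`-dimensional Hausdorff measure w.r.t. the distance `d`. -/
noncomputable def hMeas {Y : Type*} (d : Y → Y → ℝ) (s : ℝ) (Z : Set Y) : ℝ≥0∞ :=
  ⨆ (ε : ℝ≥0∞) (_ : 0 < ε), hMeasAux d s ε Z

/-- The Hausdorff dimension of `Z` w.r.t. the distance `d`. -/
noncomputable def hdim {Y : Type*} (d : Y → Y → ℝ) (Z : Set Y) : ℝ :=
  sInf {s : ℝ | 0 ≤ s ∧ hMeas d s Z = 0}

/-- The length `|x ∧ y|` of the longest common prefix of two distinct points. -/
noncomputable def wedge (x y : ℕ → A) : ℕ := sInf {n | x n ≠ y n}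

/-- The Gatzouras–Peres distance `d_φ` associated with a strictly positive continuous `φ`. -/
noncomputable def dphi (X : Set (ℕ → A)) (φ : ↥X → ℝ) (x y : ↥X) : ℝ :=
  if x = y then 0
  else Real.exp (-(sSup (birkhoff (subShift X) φ (wedge x.val y.val) ''
      {z : ↥X | ∀ i < wedge x.val y.val, z.val i = x.val i})))

/-- The word `w` occurs in `x` at position `k`. -/
def occursAt (w : List A) (x : ℕ → A) (k : ℕ) : Prop :=
  ∀ i : Fin w.length, x (k + i) = w.get i

/-- A shift of finite type: determined by a finite set of forbidden words. -/
def IsSFT {B : Type} (Z : Set (ℕ → B)) : Prop :=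
  ∃ F : Set (List B), F.Finite ∧ Z = {x | ∀ w ∈ F, ∀ k, ¬ occursAt w x k}

/-- A sofic shift: the image of a shift of finite type under a sliding block code. -/
def IsSofic (Y : Set (ℕ → A)) : Prop :=
  ∃ (B : Type) (_ : Fintype B) (Z : Set (ℕ → B)) (π : (ℕ → B) → (ℕ → A)),
    IsSFT Z ∧ Set.MapsTo shift Z Z ∧
    (∃ r : ℕ, ∀ z ∈ Z, ∀ z' ∈ Z, ∀ k, (∀ i ≤ k + r, z i = z' i) → π z k = π z' k) ∧
    (∀ z ∈ Z, π (shift z) = shift (π z)) ∧ π '' Z = Y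

/-- Topological transitivity of a subshift, via its language. -/
def IsTransitive (Y : Set (ℕ → A)) : Prop :=
  ∀ u ∈ language Y, ∀ v ∈ language Y, ∃ w : List A, u ++ w ++ v ∈ language Y

/-- The prefix of length `n` of `x`, as a word. -/
def prefixWord (x : ℕ → A) (n : ℕ) : List A := List.ofFn fun i : Fin n => x i

/-- The norm `‖m‖ = sup_{0 < ‖f‖ ≤ 1} |∫ f dm| / ‖f‖` of a measure on a compact space. -/
noncomputable def mnorm {Y : Type*} [TopologicalSpace Y] [CompactSpace Y] [MeasurableSpace Y]
    (m : Measure Y) : ℝ :=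
  sSup ((fun f : C(Y, ℝ) => |∫ y, f y ∂m| / ‖f‖) '' {f : C(Y, ℝ) | 0 < ‖f‖ ∧ ‖f‖ ≤ 1})

/-- Strict lexicographic order on `ℕ`-indexed sequences of naturals. -/
def lexLt (x y : ℕ → ℕ) : Prop := ∃ n : ℕ, (∀ i < n, x i = y i) ∧ x n < y n

/-- The β-shift: all sequences over `{0, …, b-1}` all of whose shifts are lexicographically
below the expansion `w` of `1` in base `β` (where `b = ⌈β⌉`). -/
def betaShift (b : ℕ) (w : ℕ → ℕ) : Set (ℕ → Fin b) :=
  {x | ∀ j : ℕ, 1 ≤ j → lexLt (fun i => ((shift^[j] x) i : ℕ)) w}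

/-- The S-gap shift: sequences over `{0,1}` such that the number of `0`s between any two
consecutive `1`s lies in `S`. -/
def sGapShift (S : Set ℕ) : Set (ℕ → Fin 2) :=
  {x | ∀ k l : ℕ, k < l → x k = 1 → x l = 1 →
    (∀ m : ℕ, k < m → m < l → x m = 0) → l - k - 1 ∈ S}


theorem exists_prefix_modulus {A : Type} [Finite A] [TopologicalSpace A] [DiscreteTopology A]
    {X : Set (ℕ → A)} (hXcl : IsClosed X) {φ : ↥X → ℝ} (hφ : Continuous φ) {ε : ℝ}
    (hε : 0 < ε) :
    ∃ k : ℕ, ∀ x y : ↥X, (∀ i < k, x.val i = y.val i) → |φ x - φ y| < ε := by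
  have : CompactSpace ↥X := isCompact_iff_compactSpace.mp hXcl.isCompact
  by_contra! h
  let K : ℕ → Set (↥X × ↥X) := fun k =>
    {p | (∀ i < k, p.1.val i = p.2.val i) ∧ ε ≤ |φ p.1 - φ p.2|}
  have hK : ∀ k, IsClosed (K k) := by
    intro k
    have hagree : IsClosed {p : ↥X × ↥X | ∀ i < k, p.1.val i = p.2.val i} := by
      simp only [Set.ofPred_forall]
      exact isClosed_iInter fun i => isClosed_iInter fun _ =>
        isClosed_eq ((continuous_apply i).comp (continuous_subtype_val.comp continuous_fst))
          ((continuous_apply i).comp (continuous_subtype_val.comp continuous_snd))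
    exact hagree.inter (isClosed_le continuous_const
      ((hφ.comp continuous_fst).sub (hφ.comp continuous_snd)).abs)
  obtain ⟨p, hp⟩ := IsCompact.nonempty_iInter_of_sequence_nonempty_isCompact_isClosed K
    (fun k p hp => ⟨fun i hi => hp.1 i (by omega), hp.2⟩)
    (fun k => by obtain ⟨x, y, hxy⟩ := h k; exact ⟨(x, y), hxy⟩) (hK 0).isCompact hK
  have hp' : ∀ k, p ∈ K k := fun k => Set.mem_iInter.mp hp k
  have heq : p.1 = p.2 := Subtype.ext (funext fun i => (hp' (i + 1)).1 i (Nat.lt_succ_self i))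
  have h0 := (hp' 0).2
  rw [heq, sub_self, abs_zero] at h0
  exact absurd h0 (not_le.mpr hε)

theorem exists_editPath {A : Type} (v w : List A) :
    ∃ n, ∃ f : ℕ → List A, f 0 = v ∧ f n = w ∧ ∀ i < n, EditStep (f i) (f (i + 1)) := by
  have hdel : Relation.ReflTransGen EditStep v [] := by
    induction v with
    | nil => exact .refl
    | cons a l ih => exact .head (Or.inr (Or.inr ⟨[], l, a, rfl, rfl⟩)) ih
  have hins : Relation.ReflTransGen EditStep [] w := by
    induction w with
    | nil => exact .refl
    | cons a l ih => exact .tail ih (Or.inr (Or.inl ⟨[], l, a, rfl, rfl⟩))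
  have hvw := hdel.trans hins
  clear hdel hins
  induction hvw with
  | refl => exact ⟨0, fun _ => v, rfl, rfl, fun i hi => absurd hi (Nat.not_lt_zero i)⟩
  | @tail b c _ hbc ih =>
    obtain ⟨n, f, h0, hn, hf⟩ := ih
    refine ⟨n + 1, fun i => if i ≤ n then f i else c, by simpa using h0, by simp, ?_⟩
    intro i hi
    rcases Nat.lt_succ_iff_lt_or_eq.mp hi with hi' | rfl
    · have h1 : i ≤ n := hi'.le
      have h2 : i + 1 ≤ n := hi'
      simpa [h1, h2] using hf i hi'
    · simpa [hn] using hbc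

theorem abs_sub_le_mul_editDist {A : Type} {F : List A → ℝ} {B : ℝ}
    (hF : ∀ w w', EditStep w w' → |F w - F w'| ≤ B) (v w : List A) :
    |F v - F w| ≤ B * editDist v w := by
  obtain ⟨f, h0, hn, hf⟩ : editDist v w ∈ {n | ∃ f : ℕ → List A, f 0 = v ∧ f n = w ∧
      ∀ i < n, EditStep (f i) (f (i + 1))} := Nat.sInf_mem (exists_editPath v w)
  have key : ∀ j ≤ editDist v w, |F v - F (f j)| ≤ B * j := by
    intro j
    induction j with
    | zero => simp [h0]
    | succ j ih =>
      intro hj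
      have h1 := ih (by omega)
      have h2 := hF _ _ (hf j hj)
      have h3 := abs_sub_le (F v) (F (f j)) (F (f (j + 1)))
      push_cast
      linarith
  simpa [hn] using key _ le_rfl

theorem EditStep.abs_length_sub_le {A : Type} {w w' : List A} (h : EditStep w w') :
    |(w.length : ℝ) - w'.length| ≤ 1 := by
  rcases h with ⟨u, v, a, a', rfl, rfl⟩ | ⟨u, v, a', rfl, rfl⟩ | ⟨u, v, a, rfl, rfl⟩ <;>
    · simp only [List.length_append, List.length_singleton]
      push_cast
      rw [abs_le]
      constructor <;> linarith

/-- The sum of `ψ` over all windows of length `k` of a word, where the windows starting near the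
end of the word are truncated. -/
def windowSum {A : Type} (ψ : List A → ℝ) (k : ℕ) : List A → ℝ
  | [] => 0
  | a :: l => ψ ((a :: l).take k) + windowSum ψ k l

theorem abs_windowSum_append_sub_le {A : Type} {ψ : List A → ℝ} {C : ℝ}
    (hψ : ∀ u, |ψ u| ≤ C) (k : ℕ) (u v : List A) :
    |windowSum ψ k (u ++ v) - windowSum ψ k u - windowSum ψ k v| ≤ 2 * C * k := by
  have hC : 0 ≤ C := (abs_nonneg _).trans (hψ [])
  suffices h : |windowSum ψ k (u ++ v) - windowSum ψ k u - windowSum ψ k v| ≤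
      2 * C * (min u.length k : ℕ) by
    refine h.trans (mul_le_mul_of_nonneg_left ?_ (by positivity))
    exact_mod_cast min_le_right _ _
  induction u with
  | nil => simp [windowSum]
  | cons a l ih =>
    simp only [List.cons_append, windowSum, List.length_cons]
    rcases le_or_gt k (l.length + 1) with hk | hk
    · have heq : (a :: (l ++ v)).take k = (a :: l).take k := by
        rw [← List.cons_append, List.take_append_of_le_length (by simpa using hk)]
      have hmin : (min l.length k : ℕ) ≤ (min (l.length + 1) k : ℕ) := by omega
      have hmin' : 2 * C * (min l.length k : ℕ) ≤ 2 * C * (min (l.length + 1) k : ℕ) :=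
        mul_le_mul_of_nonneg_left (by exact_mod_cast hmin) (by positivity)
      rw [heq]
      refine le_trans (le_of_eq ?_) (ih.trans hmin')
      congr 1
      ring
    · rw [min_eq_left hk.le]
      rw [min_eq_left (by omega)] at ih
      push_cast
      have h1 := abs_le.mp (hψ ((a :: (l ++ v)).take k))
      have h2 := abs_le.mp (hψ ((a :: l).take k))
      have h3 := abs_le.mp ih
      rw [abs_le]
      constructor <;> linarith [h1.1, h1.2, h2.1, h2.2, h3.1, h3.2]

theorem EditStep.abs_windowSum_sub_le {A : Type} {ψ : List A → ℝ} {C : ℝ}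
    (hψ : ∀ u, |ψ u| ≤ C) (k : ℕ) {w w' : List A} (h : EditStep w w') :
    |windowSum ψ k w - windowSum ψ k w'| ≤ 8 * C * k + 2 * C := by
  have hC : 0 ≤ C := (abs_nonneg _).trans (hψ [])
  have hCk : 0 ≤ C * k := by positivity
  have happ : ∀ u v : List A,
      |windowSum ψ k (u ++ v) - (windowSum ψ k u + windowSum ψ k v)| ≤ 2 * C * k := fun u v => by
    simpa [sub_sub] using abs_windowSum_append_sub_le hψ k u v
  have hins : ∀ (u v : List A) (a : A),
      |windowSum ψ k (u ++ [a] ++ v) - (windowSum ψ k u + windowSum ψ k v)| ≤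
        4 * C * k + C := by
    intro u v a
    have h1 := abs_le.mp (happ (u ++ [a]) v)
    have h2 := abs_le.mp (happ u [a])
    have h3 : |windowSum ψ k [a]| ≤ C := by simpa [windowSum] using hψ ([a].take k)
    have h3 := abs_le.mp h3
    rw [abs_le]
    constructor <;> linarith [h1.1, h1.2, h2.1, h2.2, h3.1, h3.2]
  rcases h with ⟨u, v, a, a', rfl, rfl⟩ | ⟨u, v, a', rfl, rfl⟩ | ⟨u, v, a, rfl, rfl⟩
  · have h1 := abs_le.mp (hins u v a)
    have h2 := abs_le.mp (hins u v a')
    rw [abs_le]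
    constructor <;> linarith [h1.1, h1.2, h2.1, h2.2]
  · have h1 := abs_le.mp (happ u v)
    have h2 := abs_le.mp (hins u v a')
    rw [abs_le]
    constructor <;> linarith [h1.1, h1.2, h2.1, h2.2]
  · have h1 := abs_le.mp (happ u v)
    have h2 := abs_le.mp (hins u v a)
    rw [abs_le]
    constructor <;> linarith [h1.1, h1.2, h2.1, h2.2]

theorem length_prefixWord {A : Type} (x : ℕ → A) (n : ℕ) : (prefixWord x n).length = n := by
  simp [prefixWord]

theorem prefixWord_succ {A : Type} (x : ℕ → A) (n : ℕ) :
    prefixWord x (n + 1) = x 0 :: prefixWord (shift x) n := by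
  simp [prefixWord, shift, List.ofFn_succ]

theorem take_prefixWord {A : Type} (x : ℕ → A) {k n : ℕ} (h : k ≤ n) :
    (prefixWord x n).take k = prefixWord x k := by
  apply List.ext_getElem
  · simp [length_prefixWord, h]
  · intro i h1 h2
    simp [prefixWord]

theorem prefixWord_eq_iff {A : Type} {x y : ℕ → A} {n : ℕ} :
    prefixWord x n = prefixWord y n ↔ ∀ i < n, x i = y i := by
  simp only [prefixWord, List.ofFn_inj, funext_iff, Fin.forall_iff]

theorem subShift_val {A : Type} {X : Set (ℕ → A)} (hX : Set.MapsTo shift X X) (x : ↥X) :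
    (subShift X x).val = shift x.val := by
  simp [subShift, hX x.property]

/-- The value of `φ` at some point of `X` whose initial word is `u`, or `0` if there is none. -/
noncomputable def sampleValue {A : Type} {X : Set (ℕ → A)} (φ : ↥X → ℝ) (u : List A) : ℝ :=
  if h : ∃ z : ↥X, prefixWord z.val u.length = u then φ h.choose else 0

theorem abs_sampleValue_le {A : Type} {X : Set (ℕ → A)} {φ : ↥X → ℝ} {C : ℝ} (hC : 0 ≤ C)
    (hφ : ∀ x, |φ x| ≤ C) (u : List A) : |sampleValue φ u| ≤ C := by
  unfold sampleValue
  split_ifs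
  · exact hφ _
  · simpa using hC

theorem abs_sub_sampleValue_lt {A : Type} {X : Set (ℕ → A)} {φ : ↥X → ℝ} {ε : ℝ} {k : ℕ}
    (hk : ∀ x y : ↥X, (∀ i < k, x.val i = y.val i) → |φ x - φ y| < ε) (x : ↥X) :
    |φ x - sampleValue φ (prefixWord x.val k)| < ε := by
  have h : ∃ z : ↥X, prefixWord z.val (prefixWord x.val k).length = prefixWord x.val k :=
    ⟨x, by rw [length_prefixWord]⟩
  rw [sampleValue, dif_pos h]
  refine hk _ _ (prefixWord_eq_iff.mp ?_)
  have hz := h.choose_spec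
  generalize h.choose = z at hz ⊢
  rw [length_prefixWord] at hz
  exact hz.symm

theorem birkhoff_succ {Y : Type*} (σ : Y → Y) (φ : Y → ℝ) (n : ℕ) (y : Y) :
    birkhoff σ φ (n + 1) y = φ y + birkhoff σ φ n (σ y) := by
  simp [birkhoff, Finset.sum_range_succ', add_comm]

theorem abs_birkhoff_le {Y : Type*} (σ : Y → Y) {φ : Y → ℝ} {C : ℝ} (hφ : ∀ y, |φ y| ≤ C)
    (n : ℕ) (y : Y) : |birkhoff σ φ n y| ≤ C * n := by
  refine (Finset.abs_sum_le_sum_abs _ _).trans ?_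
  refine (Finset.sum_le_card_nsmul _ _ C fun i _ => hφ _).trans (le_of_eq ?_)
  simp [mul_comm]

theorem abs_birkhoff_sub_windowSum_le {A : Type} {X : Set (ℕ → A)}
    (hX : Set.MapsTo shift X X) {φ : ↥X → ℝ} {C ε : ℝ} {k : ℕ} (hC : 0 ≤ C) (hε : 0 ≤ ε)
    (hφ : ∀ x, |φ x| ≤ C)
    (hk : ∀ x y : ↥X, (∀ i < k, x.val i = y.val i) → |φ x - φ y| < ε) (n : ℕ) (x : ↥X) :
    |birkhoff (subShift X) φ n x - windowSum (sampleValue φ) k (prefixWord x.val n)| ≤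
      ε * n + 2 * C * k := by
  suffices h : |birkhoff (subShift X) φ n x -
      windowSum (sampleValue φ) k (prefixWord x.val n)| ≤ ε * n + 2 * C * (min n k : ℕ) by
    have h1 : ((min n k : ℕ) : ℝ) ≤ k := by exact_mod_cast min_le_right _ _
    have h2 := mul_le_mul_of_nonneg_left h1 (by positivity : 0 ≤ 2 * C)
    linarith
  induction n generalizing x with
  | zero => simp [birkhoff, prefixWord, windowSum]
  | succ n ih =>
    have ih := abs_le.mp (ih (subShift X x))
    rw [subShift_val hX] at ih
    rw [birkhoff_succ, prefixWord_succ, windowSum, ← prefixWord_succ]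
    rcases le_or_gt k (n + 1) with h | h
    · rw [take_prefixWord _ h]
      have h1 := abs_lt.mp (abs_sub_sampleValue_lt hk x)
      have hmin : (min n k : ℕ) ≤ (min (n + 1) k : ℕ) := by omega
      have hmin' : 2 * C * (min n k : ℕ) ≤ 2 * C * (min (n + 1) k : ℕ) :=
        mul_le_mul_of_nonneg_left (by exact_mod_cast hmin) (by positivity)
      rw [abs_le]
      push_cast at *
      constructor <;> linarith [h1.1, h1.2, ih.1, ih.2]
    · rw [min_eq_left h.le]
      rw [min_eq_left (by omega)] at ih
      have h1 := abs_le.mp (hφ x)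
      have h2 := abs_le.mp
        (abs_sampleValue_le hC hφ ((prefixWord x.val (n + 1)).take k))
      rw [abs_le]
      push_cast
      constructor <;> linarith [h1.1, h1.2, h2.1, h2.2, ih.1, ih.2]

theorem abs_birkAvg_le {Y : Type*} (σ : Y → Y) {φ : Y → ℝ} {C : ℝ} (hC : 0 ≤ C)
    (hφ : ∀ y, |φ y| ≤ C) (n : ℕ) (y : Y) : |birkAvg σ φ n y| ≤ C := by
  rcases Nat.eq_zero_or_pos n with rfl | hn
  · simpa [birkAvg] using hC
  · have hn' : (0 : ℝ) < n := by exact_mod_cast hn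
    rw [birkAvg, abs_mul, abs_of_pos (inv_pos.mpr hn'), inv_mul_le_iff₀ hn', mul_comm]
    exact abs_birkhoff_le σ hφ n y

theorem abs_birkAvg_sub_le {Y : Type*} (σ : Y → Y) {φ : Y → ℝ} {C : ℝ} (hC : 0 ≤ C)
    (hφ : ∀ y, |φ y| ≤ C) {n : ℕ} (hn : 0 < n) (m : ℕ) (x y : Y) :
    |birkAvg σ φ n x - birkAvg σ φ m y| ≤
      (|birkhoff σ φ n x - birkhoff σ φ m y| + C * |(n : ℝ) - m|) / n := by
  have hn' : (0 : ℝ) < n := by exact_mod_cast hn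
  have hm : birkhoff σ φ m y = m * birkAvg σ φ m y := by
    rcases Nat.eq_zero_or_pos m with rfl | hm
    · simp [birkhoff]
    · rw [birkAvg, mul_inv_cancel_left₀ (by positivity)]
  have hx : birkhoff σ φ n x = n * birkAvg σ φ n x := by
    rw [birkAvg, mul_inv_cancel_left₀ (by positivity)]
  rw [le_div_iff₀ hn', ← abs_of_pos hn', ← abs_mul, abs_of_pos hn']
  have heq : (birkAvg σ φ n x - birkAvg σ φ m y) * n =
      (birkhoff σ φ n x - birkhoff σ φ m y) + birkAvg σ φ m y * (m - n) := by
    rw [hm, hx]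
    ring
  rw [heq]
  refine (abs_add_le _ _).trans ?_
  rw [abs_mul, abs_sub_comm (m : ℝ)]
  gcongr
  exact abs_birkAvg_le σ hC hφ m y

/-- Birkhoff averages of edit-close prefixes are uniformly close. -/
theorem statement_3 {A : Type} [Fintype A] [DecidableEq A] [TopologicalSpace A]
    [DiscreteTopology A] [MeasurableSpace A] [BorelSpace A]
    (X : Set (ℕ → A)) (hXcl : IsClosed X) (hXinv : Set.MapsTo shift X X)
    (φ : ↥X → ℝ) (hφ : Continuous φ) (g : ℕ → ℕ) (hg : MistakeFun g) :
    ∃ δ : ℕ → ℝ, (∀ n, 0 < δ n) ∧ Tendsto δ atTop (𝓝 0) ∧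
      ∀ (x y : ↥X) (n m : ℕ),
        editDist (prefixWord x.val n) (prefixWord y.val m) ≤ g n →
        |birkAvg (subShift X) φ n x - birkAvg (subShift X) φ m y| ≤ δ n := by
  have : CompactSpace ↥X := isCompact_iff_compactSpace.mp hXcl.isCompact
  obtain ⟨C, hC, hφC⟩ : ∃ C : ℝ, 0 ≤ C ∧ ∀ x, |φ x| ≤ C := by
    obtain ⟨C, hC⟩ := isCompact_univ.exists_bound_of_continuousOn hφ.continuousOn
    exact ⟨max C 0, le_max_right _ _, fun x => (hC x (Set.mem_univ x)).trans (le_max_left _ _)⟩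
  have key : ∀ ε > 0, ∀ᶠ n in atTop, ∀ (x y : ↥X) (m : ℕ),
      editDist (prefixWord x.val n) (prefixWord y.val m) ≤ g n →
      |birkAvg (subShift X) φ n x - birkAvg (subShift X) φ m y| ≤ 3 * ε := by
    intro ε hε
    obtain ⟨k, hk⟩ := exists_prefix_modulus hXcl hφ hε
    set B : ℝ := 8 * C * k + 2 * C with hB
    have hlim : Tendsto (fun n : ℕ => 2 * ε + (ε + B + C) * ((g n : ℝ) / n) +
        4 * C * k / (n : ℝ)) atTop (𝓝 (2 * ε + (ε + B + C) * 0 + 0)) :=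
      (tendsto_const_nhds.add (hg.2.const_mul _)).add
        (tendsto_const_nhds.div_atTop tendsto_natCast_atTop_atTop)
    filter_upwards [hlim.eventually_lt_const (by linarith : _ < 3 * ε), eventually_gt_atTop 0]
      with n hn hn0 x y m hd
    have hn' : (0 : ℝ) < n := by exact_mod_cast hn0
    have hd' : (editDist (prefixWord x.val n) (prefixWord y.val m) : ℝ) ≤ g n := by
      exact_mod_cast hd
    have hB0 : 0 ≤ B := by positivity
    have hlen : |(n : ℝ) - m| ≤ g n := by
      have := abs_sub_le_mul_editDist (F := fun w : List A => (w.length : ℝ))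
        (fun _ _ h => h.abs_length_sub_le) (prefixWord x.val n) (prefixWord y.val m)
      simp only [length_prefixWord, one_mul] at this
      exact this.trans hd'
    have hsum := (abs_sub_le_mul_editDist
      (fun _ _ h => h.abs_windowSum_sub_le (abs_sampleValue_le hC hφC) k)
      (prefixWord x.val n) (prefixWord y.val m)).trans (mul_le_mul_of_nonneg_left hd' hB0)
    have hx := abs_le.mp (abs_birkhoff_sub_windowSum_le hXinv hC hε.le hφC hk n x)
    have hy := abs_le.mp (abs_birkhoff_sub_windowSum_le hXinv hC hε.le hφC hk m y)
    have hm : ε * m ≤ ε * (n + g n) :=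
      mul_le_mul_of_nonneg_left (by linarith [(abs_le.mp hlen).1]) hε.le
    have hS : |birkhoff (subShift X) φ n x - birkhoff (subShift X) φ m y| ≤
        2 * ε * n + (ε + B) * g n + 4 * C * k := by
      have hs := abs_le.mp hsum
      rw [abs_le]
      constructor <;> linarith [hx.1, hx.2, hy.1, hy.2, hs.1, hs.2]
    refine (abs_birkAvg_sub_le (subShift X) hC hφC hn0 m x y).trans (le_trans ?_ hn.le)
    rw [div_le_iff₀ hn']
    have heq : (2 * ε + (ε + B + C) * ((g n : ℝ) / n) + 4 * C * k / (n : ℝ)) * n =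
        2 * ε * n + (ε + B + C) * g n + 4 * C * k := by
      field_simp
    rw [heq]
    have := mul_le_mul_of_nonneg_left hlen hC
    linarith
  let S : ℕ → Set ℝ := fun n => {r | r = 0 ∨ ∃ (x y : ↥X) (m : ℕ),
    editDist (prefixWord x.val n) (prefixWord y.val m) ≤ g n ∧
    r = |birkAvg (subShift X) φ n x - birkAvg (subShift X) φ m y|}
  have hbdd : ∀ n, BddAbove (S n) := by
    refine fun n => ⟨2 * C, ?_⟩
    rintro r (rfl | ⟨x, y, m, -, rfl⟩)
    · positivity
    · have h1 := abs_birkAvg_le (subShift X) hC hφC n x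
      have h2 := abs_birkAvg_le (subShift X) hC hφC m y
      linarith [abs_sub (birkAvg (subShift X) φ n x) (birkAvg (subShift X) φ m y)]
  have hnonneg : ∀ n, 0 ≤ sSup (S n) := fun n => le_csSup (hbdd n) (Or.inl rfl)
  refine ⟨fun n => sSup (S n) + 1 / ((n : ℝ) + 1), fun n => ?_, ?_, fun x y n m h => ?_⟩
  · exact add_pos_of_nonneg_of_pos (hnonneg n) Nat.one_div_pos_of_nat
  · have hS : Tendsto (fun n => sSup (S n)) atTop (𝓝 0) := by
      rw [Metric.tendsto_nhds]
      intro ε hε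
      filter_upwards [key (ε / 6) (by positivity)] with n hn
      rw [Real.dist_0_eq_abs, abs_of_nonneg (hnonneg n)]
      refine lt_of_le_of_lt (csSup_le ⟨0, Or.inl rfl⟩ ?_) (half_lt_self hε)
      rintro r (rfl | ⟨x, y, m, hd, rfl⟩)
      · positivity
      · linarith [hn x y m hd]
    simpa using hS.add tendsto_one_div_add_atTop_nhds_zero_nat
  · have h1 := le_csSup (hbdd n) (Or.inr ⟨x, y, m, h, rfl⟩)
    have h2 : 0 < 1 / ((n : ℝ) + 1) := Nat.one_div_pos_of_nat
    exact h1.trans (by linarith)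

end Paper
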